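/- If a is an even natural number and b and c are odd natural numbers, then Player 1 has a winning strategy in the (a,b,c)-game; that is, the state with a ones, b twos, and c threes is a first-player win in the reversed Zeckendorf game. -/

import Mathlib

/-- The Fibonacci numbers indexed so that `zfib 1 = 1`, `zfib 2 = 2`,
and `zfib (i+1) = zfib i + zfib (i-1)`. -/
def zfib (i : ℕ) : ℕ := Nat.fib (i + 1)

/-- A game state: a finitely supported function recording the height of each bin.
Bin indices start at `1`; index `0` is unused. -/
abbrev ZState := ℕ →₀ ℕ

/-- The legal moves of the reversed Zeckendorf game. -/
inductive ZMove : ZState → ZState → Prop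
  | split (h : ZState) (i : ℕ) (hi : 2 ≤ i) (hpos : 0 < h (i + 1)) :
      ZMove h (h - Finsupp.single (i + 1) 1 + Finsupp.single i 1 + Finsupp.single (i - 1) 1)
  | splitTwo (h : ZState) (hpos : 0 < h 2) :
      ZMove h (h - Finsupp.single 2 1 + Finsupp.single 1 2)
  | combine (h : ZState) (i : ℕ) (hi : 2 < i) (h1 : 0 < h (i + 1)) (h2 : 0 < h (i - 2)) :
      ZMove h (h - Finsupp.single (i + 1) 1 - Finsupp.single (i - 2) 1 + Finsupp.single i 2)
  | combineTwo (h : ZState) (h1 : 0 < h 3) (h2 : 0 < h 1) :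
      ZMove h (h - Finsupp.single 3 1 - Finsupp.single 1 1 + Finsupp.single 2 2)

mutual
  /-- The state is a first-player win: some legal move leads to a state that is a
  loss for the player then to move. -/
  inductive ZFirstWin : ZState → Prop
    | intro (h h' : ZState) (m : ZMove h h') (hl : ZLoss h') : ZFirstWin h
  /-- The state is a loss for the player to move (i.e., not a first-player win):
  every legal move leads to a first-player win for the opponent. -/
  inductive ZLoss : ZState → Prop
    | intro (h : ZState) (hall : ∀ h', ZMove h h' → ZFirstWin h') : ZLoss h
end

/-- The starting state of the `(a,b,c)`-game: `a` ones, `b` twos and `c` threes. -/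
noncomputable def abcState (a b c : ℕ) : ZState :=
  Finsupp.single 1 a + Finsupp.single 2 b + Finsupp.single 3 c

lemma abc_apply (a b c i : ℕ) : abcState a b c i =
    (if i = 1 then a else 0) + (if i = 2 then b else 0) + (if i = 3 then c else 0) := by
  simp [abcState, Finsupp.single_apply, eq_comm]

lemma abc_s3 (a b c : ℕ) : abcState a b (c+1) - Finsupp.single 3 1 + Finsupp.single 2 1 +
    Finsupp.single 1 1 = abcState (a+1) (b+1) c := by
  ext i
  simp only [Finsupp.add_apply, Finsupp.tsub_apply, abc_apply, Finsupp.single_apply]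
  split_ifs <;> omega

lemma abc_s2 (a b c : ℕ) : abcState a (b+1) c - Finsupp.single 2 1 + Finsupp.single 1 2
    = abcState (a+2) b c := by
  ext i
  simp only [Finsupp.add_apply, Finsupp.tsub_apply, abc_apply, Finsupp.single_apply]
  split_ifs <;> omega

lemma abc_c2 (a b c : ℕ) : abcState (a+1) b (c+1) - Finsupp.single 3 1 - Finsupp.single 1 1
    + Finsupp.single 2 2 = abcState a (b+2) c := by
  ext i
  simp only [Finsupp.add_apply, Finsupp.tsub_apply, abc_apply, Finsupp.single_apply]
  split_ifs <;> omega

lemma abc_m3 (a b c : ℕ) : ZMove (abcState a b (c+1)) (abcState (a+1) (b+1) c) := by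
  rw [← abc_s3]
  exact ZMove.split _ 2 le_rfl (by simp [abc_apply])

lemma abc_m2 (a b c : ℕ) : ZMove (abcState a (b+1) c) (abcState (a+2) b c) := by
  rw [← abc_s2]
  exact ZMove.splitTwo _ (by simp [abc_apply])

lemma abc_mc (a b c : ℕ) : ZMove (abcState (a+1) b (c+1)) (abcState a (b+2) c) := by
  rw [← abc_c2]
  exact ZMove.combineTwo _ (by simp [abc_apply]) (by simp [abc_apply])

lemma abc_inv (a b c : ℕ) (h' : ZState) (m : ZMove (abcState a b c) h') :
    (∃ c', c = c' + 1 ∧ h' = abcState (a+1) (b+1) c') ∨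
    (∃ b', b = b' + 1 ∧ h' = abcState (a+2) b' c) ∨
    (∃ a' c', a = a' + 1 ∧ c = c' + 1 ∧ h' = abcState a' (b+2) c') := by
  cases m with
  | split i hi hpos =>
    left
    rw [abc_apply] at hpos
    have h2 : i = 2 := by split_ifs at hpos <;> omega
    subst h2
    obtain ⟨c', rfl⟩ : ∃ c', c = c' + 1 := ⟨c - 1, by simp at hpos; omega⟩
    exact ⟨c', rfl, abc_s3 a b c'⟩
  | splitTwo hpos =>
    right; left
    rw [abc_apply] at hpos
    obtain ⟨b', rfl⟩ : ∃ b', b = b' + 1 := ⟨b - 1, by simp at hpos; omega⟩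
    exact ⟨b', rfl, abc_s2 a b' c⟩
  | combine i hi h1 h2 =>
    exfalso
    rw [abc_apply] at h1
    split_ifs at h1 <;> omega
  | combineTwo h1 h2 =>
    right; right
    rw [abc_apply] at h1 h2
    obtain ⟨c', rfl⟩ : ∃ c', c = c' + 1 := ⟨c - 1, by simp at h1; omega⟩
    obtain ⟨a', rfl⟩ : ∃ a', a = a' + 1 := ⟨a - 1, by simp at h2; omega⟩
    exact ⟨a', c', rfl, rfl, abc_c2 a' b c'⟩

/-- The losing positions of the three-bin game. -/
def AbcP (a b c : ℕ) : Prop := b % 2 = 0 ∧ ((a < c ∧ a % 2 = 0) ∨ (c ≤ a ∧ c % 2 = 0))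

lemma abc_main (n : ℕ) : ∀ a b c : ℕ, b + 3 * c < n →
    (AbcP a b c → ZLoss (abcState a b c)) ∧ (¬ AbcP a b c → ZFirstWin (abcState a b c)) := by
  induction n with
  | zero => intro a b c h; omega
  | succ n ih =>
    intro a b c hn
    constructor
    · intro hP
      refine ZLoss.intro _ fun h' m => ?_
      unfold AbcP at hP
      rcases abc_inv a b c h' m with ⟨c', rfl, rfl⟩ | ⟨b', rfl, rfl⟩ | ⟨a', c', rfl, rfl, rfl⟩
      · exact (ih _ _ _ (by omega)).2 (by unfold AbcP; omega)
      · exact (ih _ _ _ (by omega)).2 (by unfold AbcP; omega)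
      · exact (ih _ _ _ (by omega)).2 (by unfold AbcP; omega)
    · intro hP
      by_cases hb : b % 2 = 0
      · unfold AbcP at hP
        obtain ⟨c, rfl⟩ : ∃ c', c = c' + 1 := ⟨c - 1, by omega⟩
        obtain ⟨a, rfl⟩ : ∃ a', a = a' + 1 := ⟨a - 1, by omega⟩
        exact ZFirstWin.intro _ _ (abc_mc a b c)
          ((ih _ _ _ (by omega)).1 (by unfold AbcP; omega))
      · obtain ⟨b, rfl⟩ : ∃ b', b = b' + 1 := ⟨b - 1, by omega⟩
        by_cases h2 : AbcP (a+2) b c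
        · exact ZFirstWin.intro _ _ (abc_m2 a b c) ((ih _ _ _ (by omega)).1 h2)
        · unfold AbcP at h2
          obtain ⟨c, rfl⟩ : ∃ c', c = c' + 1 := ⟨c - 1, by omega⟩
          exact ZFirstWin.intro _ _ (abc_m3 a (b+1) c)
            ((ih _ _ _ (by omega)).1 (by unfold AbcP; omega))

theorem abcGame_even_odd_odd_firstPlayerWin (a b c : ℕ) (ha : Even a) (hb : Odd b) (hc : Odd c) :
    ZFirstWin (abcState a b c) := by
  refine (abc_main (b + 3 * c + 1) a b c (by omega)).2 fun h => ?_
  have := h.1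
  have := Nat.odd_iff.1 hb
  omega
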